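/- Let $(M,g)$ be a smooth Riemannian manifold of dimension $n\ge 3$ with Levi-Civita connection $\nabla$ and curvature tensor $R(X,Y)Z=\nabla_X\nabla_YZ-\nabla_Y\nabla_XZ-\nabla_{[X,Y]}Z$. For a vector field $X$ on $M$ let $X^h$ and $X^v$ be its horizontal lift (with respect to $\nabla$) and its vertical lift to $TM$; in the coordinates $(x^i,y^i)$ of $TM$ induced by coordinates $(x^i)$ of $M$, $X^v=X^i\frac{\partial}{\partial y^i}$ and $X^h=X^i\big(\frac{\partial}{\partial x^i}-y^a\Gamma^j_{ai}\frac{\partial}{\partial y^j}\big)$, where $\Gamma^j_{ai}$ are the Christoffel symbols of $\nabla$. Let $a,b,c$ be real constants with $a>0$ and $\alpha:=a(a+c)-b^2>0$, and let $G=a\,g^s+b\,g^h+c\,g^v$ be the Riemannian metric on $TM$ defined by $G(X^h,Y^h)=(a+c)\,g(X,Y)$, $G(X^h,Y^v)=G(X^v,Y^h)=b\,g(X,Y)$, $G(X^v,Y^v)=a\,g(X,Y)$. Then at every point $(x,y)\in TM$, writing $t$ for the vector $y\in T_xM$, the Riemann curvature tensor $\widetilde R$ of $(TM,G)$ satisfies,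 for all vector fields $X,Y,Z$ on $M$, $$\widetilde R(X^v,Y^v)Z^h=\Big\{\tfrac{a^2}{\alpha}R(X,Y)Z+\tfrac{a^4}{4\alpha^2}\big[R(X,t)R(Y,t)Z-R(Y,t)R(X,t)Z\big]\Big\}^h+\Big\{\tfrac{ab}{\alpha}R(Y,X)Z+\tfrac{a^3b}{4\alpha^2}\big[R(Y,t)R(X,t)Z-R(X,t)R(Y,t)Z\big]\Big\}^v .$$ -/

import Mathlib

open scoped Manifold ContDiff
open Bundle

noncomputable section

/-! ### Levi-Civita connection and curvature on a coordinate domain -/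

section Coordinates

variable {E : Type*} [NormedAddCommGroup E] [NormedSpace ℝ E]

/-- The Christoffel symbols of a metric `h` given in coordinates, `h z u v = h_{ij}(z) uⁱ vʲ`.
The vector `christoffel h z u v = Γᵏᵢⱼ(z) uⁱ vʲ` is obtained by raising, with the inverse of `h z`,
the index of the form
`w ↦ ½ ((∂_u h)(v, w) + (∂_v h)(u, w) - (∂_w h)(u, v))`. -/
def christoffel (h : E → E →L[ℝ] E →L[ℝ] ℝ) (z u : E) : E →L[ℝ] E :=
  (h z).inverse ∘L ((1 / 2 : ℝ) •
    (fderiv ℝ h z u + (fderiv ℝ h z).flip u - ((fderiv ℝ h z).flip u).flip))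

/-- The Levi-Civita covariant derivative `∇_X Y = Xⁱ (∂ᵢ Yᵏ + Γᵏᵢⱼ Yʲ) ∂ₖ`, in coordinates. -/
def coordCov (h : E → E →L[ℝ] E →L[ℝ] ℝ) (X Y : E → E) (z : E) : E :=
  fderiv ℝ Y z (X z) + christoffel h z (X z) (Y z)

/-- `R(X, Y)Z = ∇_X ∇_Y Z - ∇_Y ∇_X Z - ∇_{[X, Y]} Z` in coordinates. -/
def coordCurv (h : E → E →L[ℝ] E →L[ℝ] ℝ) (X Y Z : E → E) (z : E) : E :=
  coordCov h X (coordCov h Y Z) z - coordCov h Y (coordCov h X Z) z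
    - coordCov h (VectorField.lieBracket ℝ X Y) Z z

end Coordinates

/-! ### The curvature tensor of a manifold with a metric -/

section Curvature

variable {E : Type*} [NormedAddCommGroup E] [NormedSpace ℝ E]
  {H : Type*} [TopologicalSpace H] (I : ModelWithCorners ℝ E H)
  {N : Type*} [TopologicalSpace N] [ChartedSpace H N]

/-- The components of a tangent vector at `p` in the preferred chart at `p`. -/
def toCoord (p : N) : TangentSpace I p →L[ℝ] E :=
  mfderiv I 𝓘(ℝ, E) (extChartAt I p) p

/-- The tangent vector `uⁱ ∂ᵢ` at the point with coordinates `z`, in the preferred chart at `p`. -/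
def coordVecAt (p : N) (z : E) : E →L[ℝ] TangentSpace I ((extChartAt I p).symm z) :=
  mfderivWithin 𝓘(ℝ, E) I (extChartAt I p).symm (Set.range I) z

/-- The tangent vector at `p` whose components in the preferred chart at `p` are `u`. -/
def ofCoord (p : N) : E →L[ℝ] TangentSpace I p :=
  mfderivWithin 𝓘(ℝ, E) I (extChartAt I p).symm (Set.range I) (extChartAt I p p)

/-- The coefficients `h_{ij} = h(∂ᵢ, ∂ⱼ)` of a metric `h` in the preferred chart at `p`. -/
def metricInChart (h : ∀ q : N, TangentSpace I q →L[ℝ] TangentSpace I q →L[ℝ] ℝ) (p : N)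
    (z : E) : E →L[ℝ] E →L[ℝ] ℝ :=
  ContinuousLinearMap.bilinearComp (E := E) (F := E) (h ((extChartAt I p).symm z))
    (coordVecAt I p z) (coordVecAt I p z)

/-- The Riemann curvature tensor `R_p(u, v)w` of `(N, h)` at `p`. As `R` is a tensor, it is
evaluated on the vector fields with constant components `uⁱ ∂ᵢ`, `vⁱ ∂ᵢ`, `wⁱ ∂ᵢ`
in the preferred chart at `p`, which extend `u`, `v`, `w`. -/
def riemannCurv (h : ∀ q : N, TangentSpace I q →L[ℝ] TangentSpace I q →L[ℝ] ℝ) (p : N)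
    (u v w : TangentSpace I p) : TangentSpace I p :=
  ofCoord I p (coordCurv (metricInChart I h p)
    (fun _ => toCoord I p u) (fun _ => toCoord I p v) (fun _ => toCoord I p w)
    (extChartAt I p p))

end Curvature

/-! ### Lifts to the tangent bundle and the metric `a gˢ + b gʰ + c gᵛ`

The preferred chart of `TM` at `p = (x, y)` is the one with the coordinates `(xⁱ, yⁱ)` induced by
the preferred chart of `M` at `x`; its model vector space is `E × E`. -/

section TangentBundle

variable {E : Type*} [NormedAddCommGroup E] [NormedSpace ℝ E]
  {H : Type*} [TopologicalSpace H] (I : ModelWithCorners ℝ E H)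
  {M : Type*} [TopologicalSpace M] [ChartedSpace H M] [IsManifold I 1 M]
  (g : ∀ x : M, TangentSpace I x →L[ℝ] TangentSpace I x →L[ℝ] ℝ)

/-- The linear map `u ↦ yᵃ uⁱ Γʲₐᵢ(x)` in the preferred chart of `M` at `x`, at `p = (x, y)`. -/
def christoffelAt (p : TangentBundle I M) : E →L[ℝ] E :=
  christoffel (metricInChart I g p.proj) (extChartAt I p.proj p.proj) (toCoord I p.proj p.snd)

/-- The vertical lift `Xⁱ ∂/∂yⁱ` at `p = (x, y)` of a vector `X` at `x`. -/
def vertLift (p : TangentBundle I M) (X : TangentSpace I p.proj) :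
    TangentSpace I.tangent p :=
  ofCoord I.tangent p (0, toCoord I p.proj X)

/-- The horizontal lift `Xⁱ δ/δxⁱ = Xⁱ (∂/∂xⁱ - yᵃ Γʲₐᵢ ∂/∂yʲ)` at `p = (x, y)` of a vector `X`
at `x`. -/
def horLift (p : TangentBundle I M) (X : TangentSpace I p.proj) :
    TangentSpace I.tangent p :=
  ofCoord I.tangent p (toCoord I p.proj X, - christoffelAt I g p (toCoord I p.proj X))

/-- The vector at `x` of which the horizontal part of a vector at `p = (x, y)` is the
horizontal lift. -/
def horPart (p : TangentBundle I M) : TangentSpace I.tangent p →L[ℝ] TangentSpace I p.proj :=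
  (ofCoord I p.proj).comp
    ((ContinuousLinearMap.fst ℝ E E).comp (toCoord I.tangent p))

/-- The vector at `x` of which the vertical part of a vector at `p = (x, y)` is the vertical
lift. -/
def vertPart (p : TangentBundle I M) : TangentSpace I.tangent p →L[ℝ] TangentSpace I p.proj :=
  (ofCoord I p.proj).comp
    ((ContinuousLinearMap.snd ℝ E E
      + (christoffelAt I g p).comp (ContinuousLinearMap.fst ℝ E E)).comp (toCoord I.tangent p))

/-- The `g`-natural metric `G = a gˢ + b gʰ + c gᵛ` on `TM`, as a bilinear form on each tangent
space: `G(Xʰ, Yʰ) = (a + c) g(X, Y)`, `G(Xʰ, Yᵛ) = G(Xᵛ, Yʰ) = b g(X, Y)`,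
`G(Xᵛ, Yᵛ) = a g(X, Y)`, see `gNatural_horLift_horLift` and the lemmas after it. -/
def gNatural (a b c : ℝ) (p : TangentBundle I M) :
    TangentSpace I.tangent p →L[ℝ] TangentSpace I.tangent p →L[ℝ] ℝ :=
  let B (P Q : TangentSpace I.tangent p →L[ℝ] TangentSpace I p.proj) :
      TangentSpace I.tangent p →L[ℝ] TangentSpace I.tangent p →L[ℝ] ℝ :=
    ContinuousLinearMap.bilinearComp (E := E) (F := E) (E' := E × E) (F' := E × E) (g p.proj) P Q
  (a + c) • B (horPart I p) (horPart I p)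
    + b • (B (horPart I p) (vertPart I g p) + B (vertPart I g p) (horPart I p))
    + a • B (vertPart I g p) (vertPart I g p)

lemma gNatural_apply (a b c : ℝ) (p : TangentBundle I M) (U V : TangentSpace I.tangent p) :
    gNatural I g a b c p U V
      = (a + c) * g p.proj (horPart I p U) (horPart I p V)
        + b * (g p.proj (horPart I p U) (vertPart I g p V)
          + g p.proj (vertPart I g p U) (horPart I p V))
        + a * g p.proj (vertPart I g p U) (vertPart I g p V) :=
  rfl

end TangentBundle

/-! The four defining identities of `G`, and the decomposition `U = (hU)ʰ + (vU)ᵛ`. -/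

section Identities

variable {E : Type*} [NormedAddCommGroup E] [NormedSpace ℝ E]
  {H : Type*} [TopologicalSpace H] (I : ModelWithCorners ℝ E H)
  {N : Type*} [TopologicalSpace N] [ChartedSpace H N] [IsManifold I 1 N]

lemma toCoord_ofCoord (p : N) (u : E) : toCoord I p (ofCoord I p u) = u :=
  congrArg (fun f : E →L[ℝ] E => f u)
    (mfderiv_extChartAt_comp_mfderivWithin_extChartAt_symm' (mem_extChartAt_source p))

lemma ofCoord_toCoord (p : N) (u : TangentSpace I p) : ofCoord I p (toCoord I p u) = u :=
  congrArg (fun f : TangentSpace I p →L[ℝ] TangentSpace I p => f u)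
    (mfderivWithin_extChartAt_symm_comp_mfderiv_extChartAt' (mem_extChartAt_source p))

end Identities

section Identities

variable {E : Type*} [NormedAddCommGroup E] [NormedSpace ℝ E]
  {H : Type*} [TopologicalSpace H] (I : ModelWithCorners ℝ E H)
  {M : Type*} [TopologicalSpace M] [ChartedSpace H M] [IsManifold I 1 M]
  [IsManifold I.tangent 1 (TangentBundle I M)]
  (g : ∀ x : M, TangentSpace I x →L[ℝ] TangentSpace I x →L[ℝ] ℝ)

lemma horPart_horLift (p : TangentBundle I M) (X : TangentSpace I p.proj) :
    horPart I p (horLift I g p X) = X := by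
  simp [horPart, horLift, toCoord_ofCoord, ofCoord_toCoord]

lemma vertPart_horLift (p : TangentBundle I M) (X : TangentSpace I p.proj) :
    vertPart I g p (horLift I g p X) = 0 := by
  simp [vertPart, horLift, toCoord_ofCoord]

lemma horPart_vertLift (p : TangentBundle I M) (X : TangentSpace I p.proj) :
    horPart I p (vertLift I p X) = 0 := by
  simp [horPart, vertLift, toCoord_ofCoord]

lemma vertPart_vertLift (p : TangentBundle I M) (X : TangentSpace I p.proj) :
    vertPart I g p (vertLift I p X) = X := by
  simp [vertPart, vertLift, toCoord_ofCoord, ofCoord_toCoord]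

lemma horLift_horPart_add_vertLift_vertPart (p : TangentBundle I M)
    (U : TangentSpace I.tangent p) :
    horLift I g p (horPart I p U) + vertLift I p (vertPart I g p U) = U := by
  rw [← ofCoord_toCoord I.tangent p U]
  simp [horLift, vertLift, horPart, vertPart, toCoord_ofCoord, ← map_add]

variable (a b c : ℝ) (p : TangentBundle I M) (X Y : TangentSpace I p.proj)

lemma gNatural_horLift_horLift :
    gNatural I g a b c p (horLift I g p X) (horLift I g p Y) = (a + c) * g p.proj X Y := by
  rw [gNatural_apply]
  simp [horPart_horLift, vertPart_horLift]

lemma gNatural_horLift_vertLift :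
    gNatural I g a b c p (horLift I g p X) (vertLift I p Y) = b * g p.proj X Y := by
  rw [gNatural_apply]
  simp [horPart_horLift, vertPart_horLift, horPart_vertLift, vertPart_vertLift]

lemma gNatural_vertLift_horLift :
    gNatural I g a b c p (vertLift I p X) (horLift I g p Y) = b * g p.proj X Y := by
  rw [gNatural_apply]
  simp [horPart_horLift, vertPart_horLift, horPart_vertLift, vertPart_vertLift]

lemma gNatural_vertLift_vertLift :
    gNatural I g a b c p (vertLift I p X) (vertLift I p Y) = a * g p.proj X Y := by
  rw [gNatural_apply]
  simp [horPart_vertLift, vertPart_vertLift]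

end Identities

end

set_option maxSynthPendingDepth 3

noncomputable section

section CoordinateGeometry

variable {E : Type*} [NormedAddCommGroup E] [NormedSpace ℝ E]
  {h h' : E → E →L[ℝ] E →L[ℝ] ℝ} {U : Set E} {z : E}

/-- A smooth family of symmetric nondegenerate bilinear forms on an open set. -/
structure IsCoordMetricOn (h : E → E →L[ℝ] E →L[ℝ] ℝ) (U : Set E) : Prop where
  isOpen : IsOpen U
  contDiffOn : ContDiffOn ℝ ∞ h U
  symm : ∀ z ∈ U, ∀ u v, h z u v = h z v u
  isInvertible : ∀ z ∈ U, (h z).IsInvertible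

/-- The Christoffel symbols as a bilinear map. -/
def christoffelCLM (h : E → E →L[ℝ] E →L[ℝ] ℝ) (z : E) : E →L[ℝ] E →L[ℝ] E :=
  (ContinuousLinearMap.compL ℝ E (E →L[ℝ] ℝ) E (h z).inverse) ∘L ((1 / 2 : ℝ) •
    (fderiv ℝ h z + (fderiv ℝ h z).flip
      - (ContinuousLinearMap.flipₗᵢ ℝ E E ℝ : (E →L[ℝ] E →L[ℝ] ℝ) →L[ℝ] (E →L[ℝ] E →L[ℝ] ℝ))
        ∘L (fderiv ℝ h z).flip))

lemma christoffelCLM_apply (u : E) : christoffelCLM h z u = christoffel h z u := by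
  ext v
  simp [christoffelCLM, christoffel]

/-- The curvature tensor of `h` at `z` on constant fields. -/
def coordRiem (h : E → E →L[ℝ] E →L[ℝ] ℝ) (z u v w : E) : E :=
  fderiv ℝ (christoffelCLM h) z u v w - fderiv ℝ (christoffelCLM h) z v u w
    + christoffelCLM h z u (christoffelCLM h z v w)
    - christoffelCLM h z v (christoffelCLM h z u w)

lemma Filter.EventuallyEq.christoffel_eq (hh : h =ᶠ[nhds z] h') (u : E) :
    christoffel h z u = christoffel h' z u := by
  rw [christoffel, christoffel, hh.fderiv_eq, hh.self_of_nhds]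

lemma Filter.EventuallyEq.coordCov (hh : h =ᶠ[nhds z] h') (X Y : E → E) :
    coordCov h X Y =ᶠ[nhds z] coordCov h' X Y := by
  filter_upwards [hh.eventuallyEq_nhds] with w hw
  simp only [_root_.coordCov, hw.christoffel_eq]

lemma Filter.EventuallyEq.coordCurv_eq (hh : h =ᶠ[nhds z] h') (X Y Z : E → E) :
    coordCurv h X Y Z z = coordCurv h' X Y Z z := by
  have key : ∀ X Y Z, _root_.coordCov h X (_root_.coordCov h Y Z) z
      = _root_.coordCov h' X (_root_.coordCov h' Y Z) z := by
    intro X Y Z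
    rw [(hh.coordCov X _).self_of_nhds]
    simp only [_root_.coordCov.eq_def h' X, (hh.coordCov Y Z).fderiv_eq,
      (hh.coordCov Y Z).self_of_nhds]
  simp only [coordCurv, key, (hh.coordCov _ Z).self_of_nhds]

lemma apply_christoffel (hi : (h z).IsInvertible) (u v w : E) :
    h z (christoffel h z u v) w
      = (1 / 2) * (fderiv ℝ h z u v w + fderiv ℝ h z v u w - fderiv ℝ h z w u v) := by
  simp [christoffel, hi.self_apply_inverse]

lemma eq_christoffel (hi : (h z).IsInvertible) {u v s : E}
    (hs : ∀ w, h z s w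
      = (1 / 2) * (fderiv ℝ h z u v w + fderiv ℝ h z v u w - fderiv ℝ h z w u v)) :
    s = christoffel h z u v := by
  apply hi.injective
  ext w
  rw [hs, apply_christoffel hi]

namespace IsCoordMetricOn

lemma contDiffAt (H : IsCoordMetricOn h U) (hz : z ∈ U) : ContDiffAt ℝ ∞ h z :=
  H.contDiffOn.contDiffAt (H.isOpen.mem_nhds hz)

lemma differentiableAt (H : IsCoordMetricOn h U) (hz : z ∈ U) : DifferentiableAt ℝ h z :=
  (H.contDiffAt hz).differentiableAt (by simp)

lemma eq_of_apply_eq (H : IsCoordMetricOn h U) (hz : z ∈ U) {u v : E}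
    (huv : ∀ w, h z u w = h z v w) : u = v :=
  (H.isInvertible z hz).injective (ContinuousLinearMap.ext huv)

lemma fderiv_apply_apply (H : IsCoordMetricOn h U) (hz : z ∈ U) (u v w : E) :
    fderiv ℝ h z u v w = fderiv ℝ (fun z' => h z' v w) z u := by
  have h1 := ((H.differentiableAt hz).hasFDerivAt.clm_apply
    (hasFDerivAt_const v z)).clm_apply (hasFDerivAt_const w z)
  rw [h1.fderiv]
  simp

lemma fderiv_symm (H : IsCoordMetricOn h U) (hz : z ∈ U) (u v w : E) :
    fderiv ℝ h z u v w = fderiv ℝ h z u w v := by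
  rw [H.fderiv_apply_apply hz, H.fderiv_apply_apply hz]
  congr 1
  apply Filter.EventuallyEq.fderiv_eq
  filter_upwards [H.isOpen.mem_nhds hz] with z' hz'
  exact H.symm z' hz' v w

lemma christoffel_symm (H : IsCoordMetricOn h U) (hz : z ∈ U) (u v : E) :
    christoffelCLM h z u v = christoffelCLM h z v u := by
  rw [christoffelCLM_apply, christoffelCLM_apply]
  refine H.eq_of_apply_eq hz fun w => ?_
  rw [apply_christoffel (H.isInvertible z hz), apply_christoffel (H.isInvertible z hz),
    H.fderiv_symm hz w u v]
  ring

/-- Metric compatibility `∂_w h(u, v) = h(Γ(w, u), v) + h(u, Γ(w, v))`. -/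
lemma fderiv_eq (H : IsCoordMetricOn h U) (hz : z ∈ U) (w u v : E) :
    fderiv ℝ h z w u v
      = h z (christoffelCLM h z w u) v + h z u (christoffelCLM h z w v) := by
  rw [christoffelCLM_apply, H.symm z hz u,
    apply_christoffel (H.isInvertible z hz), apply_christoffel (H.isInvertible z hz),
    H.fderiv_symm hz w u v, H.fderiv_symm hz u w v, H.fderiv_symm hz v w u]
  ring

set_option synthInstance.maxHeartbeats 80000 in
lemma contDiffOn_christoffelCLM [CompleteSpace E] (H : IsCoordMetricOn h U) :
    ContDiffOn ℝ ∞ (christoffelCLM h) U := by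
  intro z hz
  refine ContDiffAt.contDiffWithinAt ?_
  have hd : ContDiffAt ℝ ∞ (fderiv ℝ h) z := (H.contDiffAt hz).fderiv_right (by simp)
  have hf : ContDiffAt ℝ ∞ (fun z => (fderiv ℝ h z).flip) z :=
    (ContinuousLinearMap.flipₗᵢ ℝ E E (E →L[ℝ] ℝ)).contDiff.contDiffAt.comp z hd
  have hi : ContDiffAt ℝ ∞ (fun z => (h z).inverse) z :=
    ((H.isInvertible z hz).contDiffAt_map_inverse).comp z (H.contDiffAt hz)
  refine ContDiffAt.clm_comp ?_ ?_
  · exact (ContinuousLinearMap.contDiff _).contDiffAt.comp z hi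
  · have h1 := hd.add hf
    exact ContDiffAt.const_smul _ (h1.sub (ContDiffAt.clm_comp contDiffAt_const hf))

lemma hasFDerivAt_christoffelCLM [CompleteSpace E] (H : IsCoordMetricOn h U) (hz : z ∈ U) :
    HasFDerivAt (christoffelCLM h) (fderiv ℝ (christoffelCLM h) z) z :=
  ((H.contDiffOn_christoffelCLM.contDiffAt (H.isOpen.mem_nhds hz)).differentiableAt
    (by simp)).hasFDerivAt

lemma fderiv_christoffelCLM_apply [CompleteSpace E] (H : IsCoordMetricOn h U) (hz : z ∈ U)
    (u v w : E) : fderiv ℝ (fun z => christoffelCLM h z v w) z u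
      = fderiv ℝ (christoffelCLM h) z u v w := by
  rw [(((H.hasFDerivAt_christoffelCLM hz).clm_apply
    (hasFDerivAt_const v z)).clm_apply (hasFDerivAt_const w z)).fderiv]
  simp

/-- The curvature tensor in terms of the Christoffel symbols. -/
lemma coordCurv_const [CompleteSpace E] (H : IsCoordMetricOn h U) (hz : z ∈ U) (u v w : E) :
    coordCurv h (fun _ => u) (fun _ => v) (fun _ => w) z
      = coordRiem h z u v w := by
  have hcov : ∀ v w : E, coordCov h (fun _ => v) (fun _ => w)
      = fun z => christoffelCLM h z v w := by
    intro v w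
    ext z
    simp [coordCov, christoffelCLM_apply]
  simp only [coordCurv, coordRiem, hcov]
  simp only [coordCov, H.fderiv_christoffelCLM_apply hz, ← christoffelCLM_apply,
    VectorField.lieBracket, fderiv_fun_const, Pi.zero_apply, zero_apply, sub_zero, map_zero,
    add_zero]
  abel

end IsCoordMetricOn

lemma hasFDerivAt_coordRiem (x y v w : E) :
    ∃ L : E →L[ℝ] E, HasFDerivAt (fun y => coordRiem h x y v w) L y ∧
      ∀ u, L u = coordRiem h x u v w := by
  have hid := hasFDerivAt_id (𝕜 := ℝ) y
  have hc := fun v : E => hasFDerivAt_const (𝕜 := ℝ) v y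
  have h1 := ((((hasFDerivAt_const (fderiv ℝ (christoffelCLM h) x) y).clm_apply hid).clm_apply
    (hc v)).clm_apply (hc w)).sub
    (((hasFDerivAt_const (fderiv ℝ (christoffelCLM h) x v) y).clm_apply hid).clm_apply (hc w))
  have h2 := (h1.add (((hasFDerivAt_const (christoffelCLM h x) y).clm_apply hid).clm_apply
    (hc (christoffelCLM h x v w)))).sub
    ((hasFDerivAt_const (christoffelCLM h x v) y).clm_apply
      (((hasFDerivAt_const (christoffelCLM h x) y).clm_apply hid).clm_apply (hc w)))
  refine ⟨_, h2, fun u => ?_⟩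
  simp [coordRiem]

lemma coordRiem_swap (u v w : E) : coordRiem h z u v w = -coordRiem h z v u w := by
  simp only [coordRiem]; abel

namespace IsCoordMetricOn

variable [CompleteSpace E]

lemma fderiv_christoffelCLM_symm (H : IsCoordMetricOn h U) (hz : z ∈ U) (u v w : E) :
    fderiv ℝ (christoffelCLM h) z u v w = fderiv ℝ (christoffelCLM h) z u w v := by
  rw [← H.fderiv_christoffelCLM_apply hz, ← H.fderiv_christoffelCLM_apply hz]
  congr 1
  apply Filter.EventuallyEq.fderiv_eq
  filter_upwards [H.isOpen.mem_nhds hz] with z' hz'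
  exact H.christoffel_symm hz' v w

/-- The first Bianchi identity. -/
lemma coordRiem_bianchi (H : IsCoordMetricOn h U) (hz : z ∈ U) (u v w : E) :
    coordRiem h z u v w + coordRiem h z v w u + coordRiem h z w u v = 0 := by
  simp only [coordRiem]
  rw [H.fderiv_christoffelCLM_symm hz u v w, H.fderiv_christoffelCLM_symm hz v u w,
    H.fderiv_christoffelCLM_symm hz w v u, H.christoffel_symm hz v w, H.christoffel_symm hz u w,
    H.christoffel_symm hz v u]
  abel

lemma fderiv_fderiv_eq (H : IsCoordMetricOn h U) (hz : z ∈ U) (u v w s : E) :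
    fderiv ℝ (fderiv ℝ h) z u v w s
      = fderiv ℝ h z u (christoffelCLM h z v w) s
        + h z (fderiv ℝ (christoffelCLM h) z u v w) s
        + fderiv ℝ h z u w (christoffelCLM h z v s)
        + h z w (fderiv ℝ (christoffelCLM h) z u v s) := by
  have hd : HasFDerivAt (fderiv ℝ h) (fderiv ℝ (fderiv ℝ h) z) z :=
    (((H.contDiffAt hz).fderiv_right (m := ∞) (by simp)).differentiableAt (by simp)).hasFDerivAt
  have h1 := ((hd.clm_apply (hasFDerivAt_const v z)).clm_apply
    (hasFDerivAt_const w z)).clm_apply (hasFDerivAt_const s z)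
  have hΓ := fun w => (((H.hasFDerivAt_christoffelCLM hz).clm_apply
      (hasFDerivAt_const v z)).clm_apply (hasFDerivAt_const w z))
  have hh := (H.differentiableAt hz).hasFDerivAt
  have h2 := ((hh.clm_apply (hΓ w)).clm_apply (hasFDerivAt_const s z)).add
    ((hh.clm_apply (hasFDerivAt_const w z)).clm_apply (hΓ s))
  have h3 := h2.congr_of_eventuallyEq (f₁ := fun z => fderiv ℝ h z v w s) (by
    filter_upwards [H.isOpen.mem_nhds hz] with z' hz'
    exact H.fderiv_eq hz' v w s)
  have := congrArg (fun L => L u) (h1.unique h3)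
  simp at this
  rw [this]
  ring

/-- The curvature operator is skew-adjoint. -/
lemma apply_coordRiem_skew (H : IsCoordMetricOn h U) (hz : z ∈ U) (u v w s : E) :
    h z (coordRiem h z u v w) s = -h z (coordRiem h z u v s) w := by
  have hs : fderiv ℝ (fderiv ℝ h) z u v = fderiv ℝ (fderiv ℝ h) z v u :=
    (H.contDiffAt hz).isSymmSndFDerivAt
      (by rw [minSmoothness_of_isRCLikeNormedField]; exact WithTop.coe_le_coe.2 le_top) u v
  have hs' := congrArg (fun L => L w s) hs
  simp only [H.fderiv_fderiv_eq hz, H.fderiv_eq hz] at hs'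
  rw [H.symm z hz (coordRiem h z u v s)]
  simp only [coordRiem, map_add, map_sub, add_apply,
    sub_apply]
  linarith

/-- The pair symmetry of the curvature tensor. -/
lemma apply_coordRiem_pair (H : IsCoordMetricOn h U) (hz : z ∈ U) (u v w s : E) :
    h z (coordRiem h z u v w) s = h z (coordRiem h z w s u) v := by
  have hb : ∀ a b c d, h z (coordRiem h z a b c) d + h z (coordRiem h z b c a) d
      + h z (coordRiem h z c a b) d = 0 := by
    intro a b c d
    rw [← add_apply, ← map_add, ← add_apply, ← map_add,
      H.coordRiem_bianchi hz]
    simp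
  have hsw : ∀ a b c d, h z (coordRiem h z a b c) d = -h z (coordRiem h z b a c) d := by
    intro a b c d
    rw [coordRiem_swap, map_neg, neg_apply]
  have hsk := H.apply_coordRiem_skew hz
  linarith [hb u v w s, hb v w s u, hb w s u v, hb s u v w,
    hsw u v w s, hsw u v s w, hsw v w u s, hsw v w s u, hsw w u v s, hsw w u s v,
    hsw u s v w, hsw u s w v, hsw v s u w, hsw v s w u, hsw w s u v, hsw w s v u,
    hsk u v w s, hsk v w u s, hsk w u v s, hsk u s v w, hsk v s u w, hsk w s u v,
    hsk v u w s, hsk w v u s, hsk u w v s, hsk s u v w, hsk s v u w, hsk s w u v]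

end IsCoordMetricOn

end CoordinateGeometry

section CoordinateChange

variable {E : Type*} [NormedAddCommGroup E] [NormedSpace ℝ E]
  {h h' : E → E →L[ℝ] E →L[ℝ] ℝ} {U U' : Set E} {z : E} {φ : E → E}

lemma fderiv_metric_pullback (H : IsCoordMetricOn h U) (H' : IsCoordMetricOn h' U')
    (hz : z ∈ U) (hφz : φ z ∈ U') (hφ : ContDiffAt ℝ ∞ φ z)
    (hh : ∀ᶠ z' in nhds z, ∀ u v, h z' u v = h' (φ z') (fderiv ℝ φ z' u) (fderiv ℝ φ z' v))
    (w u v : E) :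
    fderiv ℝ h z w u v
      = fderiv ℝ h' (φ z) (fderiv ℝ φ z w) (fderiv ℝ φ z u) (fderiv ℝ φ z v)
        + h' (φ z) (fderiv ℝ (fderiv ℝ φ) z w u) (fderiv ℝ φ z v)
        + h' (φ z) (fderiv ℝ φ z u) (fderiv ℝ (fderiv ℝ φ) z w v) := by
  have hφ1 : HasFDerivAt φ (fderiv ℝ φ z) z := (hφ.differentiableAt (by simp)).hasFDerivAt
  have hφ2 : HasFDerivAt (fderiv ℝ φ) (fderiv ℝ (fderiv ℝ φ) z) z :=
    ((hφ.fderiv_right (m := ∞) (by simp)).differentiableAt (by simp)).hasFDerivAt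
  have hc := ((H'.differentiableAt hφz).hasFDerivAt).comp z hφ1
  have hD := fun u => hφ2.clm_apply (hasFDerivAt_const u z)
  have h1 := (hc.clm_apply (hD u)).clm_apply (hD v)
  have h2 := h1.congr_of_eventuallyEq (f₁ := fun z => h z u v) (by
    filter_upwards [hh] with z' hz'
    exact hz' u v)
  rw [H.fderiv_apply_apply hz, h2.fderiv]
  simp
  ring

/-- The transformation law of the Christoffel symbols under a change of coordinates. -/
lemma fderiv_apply_christoffel (H : IsCoordMetricOn h U) (H' : IsCoordMetricOn h' U')
    (hz : z ∈ U) (hφz : φ z ∈ U') (hφ : ContDiffAt ℝ ∞ φ z)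
    (hsurj : Function.Surjective (fderiv ℝ φ z))
    (hh : ∀ᶠ z' in nhds z, ∀ u v, h z' u v = h' (φ z') (fderiv ℝ φ z' u) (fderiv ℝ φ z' v))
    (u v : E) :
    fderiv ℝ φ z (christoffelCLM h z u v)
      = fderiv ℝ (fderiv ℝ φ) z u v
        + christoffelCLM h' (φ z) (fderiv ℝ φ z u) (fderiv ℝ φ z v) := by
  refine H'.eq_of_apply_eq hφz fun w' => ?_
  obtain ⟨w, rfl⟩ := hsurj w'
  have hs : ∀ u v, fderiv ℝ (fderiv ℝ φ) z u v = fderiv ℝ (fderiv ℝ φ) z v u :=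
    hφ.isSymmSndFDerivAt
      (by rw [minSmoothness_of_isRCLikeNormedField]; exact WithTop.coe_le_coe.2 le_top)
  rw [← hh.self_of_nhds, christoffelCLM_apply, apply_christoffel (H.isInvertible z hz), map_add,
    add_apply, christoffelCLM_apply, apply_christoffel (H'.isInvertible _ hφz)]
  simp only [fderiv_metric_pullback H H' hz hφz hφ hh]
  rw [hs v u, hs w u, hs w v, H'.symm _ hφz (fderiv ℝ φ z v) (fderiv ℝ (fderiv ℝ φ) z u w),
    H'.symm _ hφz (fderiv ℝ φ z u) (fderiv ℝ (fderiv ℝ φ) z v w)]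
  ring

end CoordinateChange

section NaturalMetricInCoordinates

variable {E : Type*} [NormedAddCommGroup E] [NormedSpace ℝ E]
  {h : E → E →L[ℝ] E →L[ℝ] ℝ} {U : Set E} {a b c : ℝ}

lemma ContDiffAt.clm_bilinearComp {D E₁ E₂ F : Type*} [NormedAddCommGroup D] [NormedSpace ℝ D]
    [NormedAddCommGroup E₁] [NormedSpace ℝ E₁] [NormedAddCommGroup E₂] [NormedSpace ℝ E₂]
    [NormedAddCommGroup F] [NormedSpace ℝ F]
    {f : D → E₁ →L[ℝ] E₁ →L[ℝ] F} {A B : D → E₂ →L[ℝ] E₁} {n : WithTop ℕ∞} {z : D}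
    (hf : ContDiffAt ℝ n f z) (hA : ContDiffAt ℝ n A z) (hB : ContDiffAt ℝ n B z) :
    ContDiffAt ℝ n (fun z => (f z).bilinearComp (A z) (B z)) z :=
  (ContinuousLinearMap.flipₗᵢ ℝ E₂ E₂ F).contDiff.contDiffAt.comp z
    (((ContinuousLinearMap.flipₗᵢ ℝ E₂ E₁ F).contDiff.contDiffAt.comp z
      (hf.clm_comp hA)).clm_comp hB)

lemma ContinuousLinearMap.isInvertible_of_injective [FiniteDimensional ℝ E]
    {f : E →L[ℝ] E →L[ℝ] ℝ} (hf : Function.Injective f) : f.IsInvertible := by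
  have hfin : Module.finrank ℝ E = Module.finrank ℝ (E →L[ℝ] ℝ) := by
    rw [← (LinearMap.toContinuousLinearMap (𝕜 := ℝ) (E := E) (F' := ℝ)).finrank_eq]
    exact (Subspace.dual_finrank_eq (K := ℝ) (V := E)).symm
  refine ⟨(LinearEquiv.ofInjectiveOfFinrankEq (f : E →ₗ[ℝ] E →L[ℝ] ℝ) hf
    hfin).toContinuousLinearEquiv, ?_⟩
  ext
  rfl

/-- The vertical part `v + Γ(y, u)` of the vector `(u, v)` at `(x, y)`, in coordinates. -/
def coordVert (h : E → E →L[ℝ] E →L[ℝ] ℝ) (z : E × E) : E × E →L[ℝ] E :=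
  ContinuousLinearMap.snd ℝ E E + (christoffelCLM h z.1 z.2).comp (ContinuousLinearMap.fst ℝ E E)

/-- The metric `a gˢ + b gʰ + c gᵛ` in the coordinates `(xⁱ, yⁱ)`. -/
def coordNatural (h : E → E →L[ℝ] E →L[ℝ] ℝ) (a b c : ℝ) (z : E × E) :
    E × E →L[ℝ] E × E →L[ℝ] ℝ :=
  (a + c) • (h z.1).bilinearComp (ContinuousLinearMap.fst ℝ E E) (ContinuousLinearMap.fst ℝ E E)
    + b • ((h z.1).bilinearComp (ContinuousLinearMap.fst ℝ E E) (coordVert h z)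
      + (h z.1).bilinearComp (coordVert h z) (ContinuousLinearMap.fst ℝ E E))
    + a • (h z.1).bilinearComp (coordVert h z) (coordVert h z)

lemma coordVert_apply (z V : E × E) : coordVert h z V = V.2 + christoffelCLM h z.1 z.2 V.1 := rfl

lemma coordNatural_apply (z V W : E × E) :
    coordNatural h a b c z V W = (a + c) * h z.1 V.1 W.1
      + b * (h z.1 V.1 (coordVert h z W) + h z.1 (coordVert h z V) W.1)
      + a * h z.1 (coordVert h z V) (coordVert h z W) := rfl

namespace IsCoordMetricOn

lemma contDiffAt_coordVert [CompleteSpace E] (H : IsCoordMetricOn h U) {z : E × E}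
    (hz : z.1 ∈ U) : ContDiffAt ℝ ∞ (coordVert h) z := by
  have hΓ : ContDiffAt ℝ ∞ (fun z : E × E => christoffelCLM h z.1) z :=
    (H.contDiffOn_christoffelCLM.contDiffAt (H.isOpen.mem_nhds hz)).comp z contDiffAt_fst
  exact contDiffAt_const.add ((hΓ.clm_apply contDiffAt_snd).clm_comp contDiffAt_const)

lemma contDiffAt_coordNatural [CompleteSpace E] (H : IsCoordMetricOn h U) {z : E × E}
    (hz : z.1 ∈ U) : ContDiffAt ℝ ∞ (coordNatural h a b c) z := by
  have hh : ContDiffAt ℝ ∞ (fun z : E × E => h z.1) z := (H.contDiffAt hz).comp z contDiffAt_fst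
  have hK := H.contDiffAt_coordVert hz
  have hc : ContDiffAt ℝ ∞ (fun _ : E × E => ContinuousLinearMap.fst ℝ E E) z := contDiffAt_const
  exact (((hh.clm_bilinearComp hc hc).const_smul _).add
    (((hh.clm_bilinearComp hc hK).add (hh.clm_bilinearComp hK hc)).const_smul _)).add
    ((hh.clm_bilinearComp hK hK).const_smul _)

lemma coordNatural_injective (H : IsCoordMetricOn h U) (hα : a * (a + c) - b ^ 2 ≠ 0)
    {z : E × E} (hz : z.1 ∈ U) : Function.Injective (coordNatural h a b c z) := by
  rw [injective_iff_map_eq_zero]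
  intro V hV
  have h1 : b • V.1 + a • coordVert h z V = 0 := by
    refine H.eq_of_apply_eq hz fun w => ?_
    have := congrArg (fun L => L ((0, w) : E × E)) hV
    simpa [coordNatural_apply, coordVert_apply (V := (0, w))] using this
  have h2 : (a + c) • V.1 + b • coordVert h z V = 0 := by
    refine H.eq_of_apply_eq hz fun w => ?_
    have := congrArg (fun L => L ((w, -christoffelCLM h z.1 z.2 w) : E × E)) hV
    have hK : coordVert h z (w, -christoffelCLM h z.1 z.2 w) = 0 := by simp [coordVert_apply]
    simpa [coordNatural_apply, hK] using this
  have h3 : V.1 = 0 := by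
    have : (a * (a + c) - b ^ 2) • V.1 = 0 := by
      linear_combination (norm := module) a • h2 - b • h1
    exact (smul_eq_zero.1 this).resolve_left hα
  have h4 : coordVert h z V = 0 := by
    have : (a * (a + c) - b ^ 2) • coordVert h z V = 0 := by
      linear_combination (norm := module) (a + c) • h1 - b • h2
    exact (smul_eq_zero.1 this).resolve_left hα
  rw [coordVert_apply, h3, map_zero, add_zero] at h4
  exact Prod.ext h3 h4

lemma coordNatural [FiniteDimensional ℝ E] (H : IsCoordMetricOn h U)
    (hα : a * (a + c) - b ^ 2 ≠ 0) :
    IsCoordMetricOn (coordNatural h a b c) (U ×ˢ Set.univ) where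
  isOpen := H.isOpen.prod isOpen_univ
  contDiffOn := fun z hz =>
    have := FiniteDimensional.complete ℝ E
    (H.contDiffAt_coordNatural hz.1).contDiffWithinAt
  symm := fun z hz V W => by
    rw [coordNatural_apply, coordNatural_apply, H.symm _ hz.1 W.1, H.symm _ hz.1 W.1,
      H.symm _ hz.1 (coordVert h z W) V.1, H.symm _ hz.1 (coordVert h z W) (coordVert h z V)]
    ring
  isInvertible := fun z hz =>
    ContinuousLinearMap.isInvertible_of_injective (H.coordNatural_injective hα hz.1)

lemma hasFDerivAt_coordVert_apply [CompleteSpace E] (H : IsCoordMetricOn h U) {z : E × E}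
    (hz : z.1 ∈ U) (V : E × E) :
    ∃ L : E × E →L[ℝ] E, HasFDerivAt (fun z => coordVert h z V) L z ∧ ∀ ξ, L ξ
      = fderiv ℝ (christoffelCLM h) z.1 ξ.1 z.2 V.1 + christoffelCLM h z.1 ξ.2 V.1 := by
  have h1 := ((((H.hasFDerivAt_christoffelCLM hz).comp z hasFDerivAt_fst).clm_apply
    hasFDerivAt_snd).clm_apply (hasFDerivAt_const V.1 z)).const_add V.2
  refine ⟨_, h1, fun ξ => ?_⟩
  simp [add_comm]

lemma fderiv_coordNatural [FiniteDimensional ℝ E] (H : IsCoordMetricOn h U)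
    (hα : a * (a + c) - b ^ 2 ≠ 0) {z : E × E} (hz : z.1 ∈ U) (ξ V W : E × E) :
    fderiv ℝ (_root_.coordNatural h a b c) z ξ V W
      = (a + c) * fderiv ℝ h z.1 ξ.1 V.1 W.1
        + b * (fderiv ℝ h z.1 ξ.1 V.1 (coordVert h z W)
          + h z.1 V.1 (fderiv ℝ (christoffelCLM h) z.1 ξ.1 z.2 W.1 + christoffelCLM h z.1 ξ.2 W.1)
          + (fderiv ℝ h z.1 ξ.1 (coordVert h z V) W.1
          + h z.1 (fderiv ℝ (christoffelCLM h) z.1 ξ.1 z.2 V.1 + christoffelCLM h z.1 ξ.2 V.1)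
              W.1))
        + a * (fderiv ℝ h z.1 ξ.1 (coordVert h z V) (coordVert h z W)
          + h z.1 (fderiv ℝ (christoffelCLM h) z.1 ξ.1 z.2 V.1 + christoffelCLM h z.1 ξ.2 V.1)
              (coordVert h z W)
          + h z.1 (coordVert h z V)
              (fderiv ℝ (christoffelCLM h) z.1 ξ.1 z.2 W.1 + christoffelCLM h z.1 ξ.2 W.1)) := by
  have := FiniteDimensional.complete ℝ E
  rw [(H.coordNatural hα).fderiv_apply_apply ⟨hz, trivial⟩]
  obtain ⟨LV, hV, hLV⟩ := H.hasFDerivAt_coordVert_apply hz V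
  obtain ⟨LW, hW, hLW⟩ := H.hasFDerivAt_coordVert_apply hz W
  have hh : HasFDerivAt (fun z : E × E => h z.1)
      ((fderiv ℝ h z.1).comp (ContinuousLinearMap.fst ℝ E E)) z :=
    (H.differentiableAt hz).hasFDerivAt.comp z hasFDerivAt_fst
  have hc := fun v : E => hasFDerivAt_const (𝕜 := ℝ) v z
  have key := (((hh.clm_apply (hc V.1)).clm_apply (hc W.1)).const_mul (a + c)).add
    ((((hh.clm_apply (hc V.1)).clm_apply hW).add
      ((hh.clm_apply hV).clm_apply (hc W.1))).const_mul b)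
    |>.add (((hh.clm_apply hV).clm_apply hW).const_mul a)
  have key' : HasFDerivAt (fun z => _root_.coordNatural h a b c z V W) _ z := key
  rw [key'.fderiv]
  simp only [← hLV, ← hLW]
  simp
  ring

end IsCoordMetricOn

end NaturalMetricInCoordinates

section NaturalMetricCurvature

variable {E : Type*} [NormedAddCommGroup E] [NormedSpace ℝ E] [FiniteDimensional ℝ E]
  {h : E → E →L[ℝ] E →L[ℝ] ℝ} {U : Set E} {a b c : ℝ}

namespace IsCoordMetricOn

/-- The covariant derivative in a vertical direction for the metric `a gˢ + b gʰ + c gᵛ`. -/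
lemma christoffelCLM_coordNatural (H : IsCoordMetricOn h U) 
    (hα : a * (a + c) - b ^ 2 ≠ 0) {x : E} (hx : x ∈ U) (y u v w : E) :
    christoffelCLM (_root_.coordNatural h a b c) (x, y) (0, u) (v, w)
      = ((a ^ 2 / (2 * (a * (a + c) - b ^ 2))) • coordRiem h x y u v,
        christoffelCLM h x u v
          - christoffelCLM h x y ((a ^ 2 / (2 * (a * (a + c) - b ^ 2))) • coordRiem h x y u v)
          - (a * b / (2 * (a * (a + c) - b ^ 2))) • coordRiem h x y u v) := by
  have := FiniteDimensional.complete ℝ E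
  have hz : (x, y) ∈ U ×ˢ (Set.univ : Set E) := ⟨hx, trivial⟩
  have HG := H.coordNatural hα
  rw [christoffelCLM_apply]
  refine (eq_christoffel (HG.isInvertible _ hz) ?_).symm
  rintro ⟨p, q⟩
  simp only [H.fderiv_coordNatural hα (z := (x, y)) hx, coordNatural_apply, coordVert_apply,
    H.fderiv_eq hx]
  have hR : (a ^ 2 / (2 * (a * (a + c) - b ^ 2))) * (a + c)
      - (a * b / (2 * (a * (a + c) - b ^ 2))) * b = a / 2 := by
    field_simp
  have hR' : (a ^ 2 / (2 * (a * (a + c) - b ^ 2))) * b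
      - (a * b / (2 * (a * (a + c) - b ^ 2))) * a = 0 := by
    ring
  have hP := H.apply_coordRiem_pair hx y u v p
  rw [H.symm x hx _ u] at hP
  generalize a ^ 2 / (2 * (a * (a + c) - b ^ 2)) = k at *
  generalize a * b / (2 * (a * (a + c) - b ^ 2)) = l at *
  generalize coordRiem h x y u v = r at *
  simp only [coordRiem, map_add, map_sub] at hP
  rw [H.christoffel_symm hx p y, H.christoffel_symm hx v y,
    H.fderiv_christoffelCLM_symm hx v p y, H.fderiv_christoffelCLM_symm hx p v y] at hP
  simp only [map_zero, add_zero, zero_add, map_add, map_sub, add_apply, sub_apply, zero_apply,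
    map_smul, smul_apply, smul_eq_mul, mul_zero]
  rw [H.christoffel_symm hx w p, H.christoffel_symm hx q v, H.christoffel_symm hx v u,
    H.christoffel_symm hx p u, H.christoffel_symm hx p v]
  linear_combination hR * h x r p + hR' * (h x r q + h x r (christoffelCLM h x y p))
    + (a / 2) * hP + (a / 2) * H.symm x hx (christoffelCLM h x u p) w
    + (a / 2) * H.symm x hx (christoffelCLM h x u p) (christoffelCLM h x y v)
    + (b / 2) * H.symm x hx (christoffelCLM h x u p) v

lemma fderiv_christoffelCLM_coordNatural (H : IsCoordMetricOn h U)
    (hα : a * (a + c) - b ^ 2 ≠ 0) {x : E} (hx : x ∈ U) (y u v w s : E) :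
    fderiv ℝ (christoffelCLM (_root_.coordNatural h a b c)) (x, y) (0, u) (0, v) (w, s)
      = ((a ^ 2 / (2 * (a * (a + c) - b ^ 2))) • coordRiem h x u v w,
        -((a ^ 2 / (2 * (a * (a + c) - b ^ 2))) • (christoffelCLM h x u (coordRiem h x y v w)
            + christoffelCLM h x y (coordRiem h x u v w)))
          - (a * b / (2 * (a * (a + c) - b ^ 2))) • coordRiem h x u v w) := by
  have := FiniteDimensional.complete ℝ E
  have hz : (x, y) ∈ U ×ˢ (Set.univ : Set E) := ⟨hx, trivial⟩
  have HG := H.coordNatural hα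
  have h1 := ((((HG.hasFDerivAt_christoffelCLM hz).comp y (hasFDerivAt_prodMk_right x y)).clm_apply
    (hasFDerivAt_const ((0, v) : E × E) y)).clm_apply (hasFDerivAt_const ((w, s) : E × E) y))
  obtain ⟨L, hL, hLu⟩ := hasFDerivAt_coordRiem (h := h) x y v w
  set k := a ^ 2 / (2 * (a * (a + c) - b ^ 2)) with hk
  set l := a * b / (2 * (a * (a + c) - b ^ 2)) with hl
  have h2 := (hL.const_smul k).prodMk
    ((((hasFDerivAt_const (christoffelCLM h x v w) y)).sub
    (((hasFDerivAt_const (christoffelCLM h x) y).clm_apply (hasFDerivAt_id y)).clm_apply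
      (hL.const_smul k))).sub (hL.const_smul l))
  have h3 := h2.congr_of_eventuallyEq
    (f₁ := fun y => christoffelCLM (_root_.coordNatural h a b c) (x, y) (0, v) (w, s))
    (Filter.Eventually.of_forall fun y => H.christoffelCLM_coordNatural hα hx y v w s)
  have h4 := congrArg (fun L => L u) (h1.unique h3)
  simp [hLu] at h4
  rw [h4]
  congr 1
  module

/-- The curvature of the metric `a gˢ + b gʰ + c gᵛ` on two vertical vectors, in coordinates. -/
lemma coordRiem_coordNatural (H : IsCoordMetricOn h U) {α : ℝ} (hα : α = a * (a + c) - b ^ 2)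
    (hα0 : α ≠ 0) {x : E} (hx : x ∈ U) (y u v w s : E) :
    coordRiem (_root_.coordNatural h a b c) (x, y) (0, u) (0, v) (w, s)
      = ((a ^ 2 / α) • coordRiem h x u v w + (a ^ 4 / (4 * α ^ 2)) •
          (coordRiem h x u y (coordRiem h x v y w) - coordRiem h x v y (coordRiem h x u y w)),
        -christoffelCLM h x y ((a ^ 2 / α) • coordRiem h x u v w + (a ^ 4 / (4 * α ^ 2)) •
          (coordRiem h x u y (coordRiem h x v y w) - coordRiem h x v y (coordRiem h x u y w)))
        + ((a * b / α) • coordRiem h x v u w + (a ^ 3 * b / (4 * α ^ 2)) •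
          (coordRiem h x v y (coordRiem h x u y w)
            - coordRiem h x u y (coordRiem h x v y w)))) := by
  rw [coordRiem, H.fderiv_christoffelCLM_coordNatural (hα ▸ hα0) hx,
    H.fderiv_christoffelCLM_coordNatural (hα ▸ hα0) hx,
    H.christoffelCLM_coordNatural (hα ▸ hα0) hx, H.christoffelCLM_coordNatural (hα ▸ hα0) hx,
    H.christoffelCLM_coordNatural (hα ▸ hα0) hx, H.christoffelCLM_coordNatural (hα ▸ hα0) hx,
    ← hα]
  have hneg : ∀ u v w, coordRiem h x u v (-w) = -coordRiem h x u v w := by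
    intro u v w
    simp only [coordRiem, map_neg]; abel
  have hsmul : ∀ (k : ℝ) u v w, coordRiem h x u v (k • w) = k • coordRiem h x u v w := by
    intro k u v w
    simp only [coordRiem, map_smul, smul_sub, smul_add]
  rw [coordRiem_swap v u w, coordRiem_swap u y w, coordRiem_swap v y w, hneg, hneg,
    coordRiem_swap u y, coordRiem_swap v y]
  simp only [hsmul, neg_neg, map_add, map_sub, map_smul, map_neg]
  ext
  · simp only [Prod.fst_add, Prod.fst_sub]
    module
  · simp only [Prod.snd_add, Prod.snd_sub]
    module

end IsCoordMetricOn

end NaturalMetricCurvature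

section Charts

variable {E : Type*} [NormedAddCommGroup E] [NormedSpace ℝ E]
  {H : Type*} [TopologicalSpace H] (I : ModelWithCorners ℝ E H)
  {M : Type*} [TopologicalSpace M] [ChartedSpace H M]

/-- The change of coordinates from the preferred chart at `x` to the preferred chart at `x'`. -/
def chartTransition (x x' : M) : E → E := extChartAt I x' ∘ (extChartAt I x).symm

lemma toCoord_apply [IsManifold I 1 M] (x : M) (u : TangentSpace I x) : toCoord I x u = u :=
  congrArg (fun L : E →L[ℝ] E => L u) (mfderiv_extChartAt_self (I := I) (x := x))

lemma ofCoord_apply [IsManifold I 1 M] (x : M) (u : E) : ofCoord I x u = u :=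
  congrArg (fun L : E →L[ℝ] E => L u) (mfderivWithin_range_extChartAt_symm (I := I) (x := x))

lemma mem_extChartAt_tangent_target [IsManifold I 1 M] (p : TangentBundle I M) (z : E × E) :
    z ∈ (extChartAt I.tangent p).target ↔ z.1 ∈ (extChartAt I p.proj).target := by
  rw [FiberBundle.extChartAt_target]
  simp only [Set.mem_prod, Set.mem_univ, and_true, Set.mem_inter_iff, Set.mem_preimage,
    TangentBundle.trivializationAt_baseSet, and_iff_left_iff_imp]
  intro hz
  simpa using (extChartAt I p.proj).map_target hz

variable [I.Boundaryless]

lemma tangentCoordChange_eq_fderiv [IsManifold I 1 M] {x x' : M} {z : E}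
    (hz : z ∈ (extChartAt I x).target) :
    tangentCoordChange I x x' ((extChartAt I x).symm z) = fderiv ℝ (chartTransition I x x') z := by
  rw [tangentCoordChange_def, (extChartAt I x).right_inv hz, I.range_eq_univ, fderivWithin_univ]
  rfl

lemma coordVecAt_apply [IsManifold I 1 M] {x : M} {z : E} (hz : z ∈ (extChartAt I x).target)
    (u : E) : coordVecAt I x z u
      = fderiv ℝ (chartTransition I x ((extChartAt I x).symm z)) z u := by
  have hq : (extChartAt I x).symm z ∈ (chartAt H x).source := by
    simpa using (extChartAt I x).map_target hz
  have h1 := TangentBundle.symmL_trivializationAt (𝕜 := ℝ) (I := I) hq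
  rw [TangentBundle.symmL_trivializationAt_eq_core hq, (extChartAt I x).right_inv hz] at h1
  rw [← tangentCoordChange_eq_fderiv I hz]
  exact congrArg (fun L : E →L[ℝ] E => L u) h1.symm

lemma contDiffAt_chartTransition [IsManifold I ∞ M] {x x' : M} {z : E}
    (hz : z ∈ (extChartAt I x).target) (hz' : (extChartAt I x).symm z ∈ (extChartAt I x').source) :
    ContDiffAt ℝ ∞ (chartTransition I x x') z := by
  have := contDiffWithinAt_ext_coord_change (I := I) (n := ∞) x' x (y := z) (by simp_all)
  rwa [I.range_eq_univ, contDiffWithinAt_univ] at this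

/-- The cocycle condition for the derivatives of the changes of coordinates. -/
lemma fderiv_chartTransition_comp [IsManifold I 1 M] {x x' x'' : M} {z : E}
    (hz : z ∈ (extChartAt I x).target) (hz' : (extChartAt I x).symm z ∈ (extChartAt I x').source)
    (hz'' : (extChartAt I x).symm z ∈ (extChartAt I x'').source) (u : E) :
    fderiv ℝ (chartTransition I x' x'') (chartTransition I x x' z)
      (fderiv ℝ (chartTransition I x x') z u) = fderiv ℝ (chartTransition I x x'') z u := by
  have h1 := tangentCoordChange_comp (I := I) (w := x) (x := x') (y := x'') (v := u)
    ⟨⟨(extChartAt I x).map_target hz, hz'⟩, hz''⟩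
  have h2 : chartTransition I x x' z ∈ (extChartAt I x').target := (extChartAt I x').map_source hz'
  have h3 : (extChartAt I x').symm (chartTransition I x x' z) = (extChartAt I x).symm z :=
    (extChartAt I x').left_inv hz'
  rwa [tangentCoordChange_eq_fderiv I hz, tangentCoordChange_eq_fderiv I hz, ← h3,
    tangentCoordChange_eq_fderiv I h2] at h1

lemma fderiv_chartTransition_self [IsManifold I 1 M] {x : M} {z : E}
    (hz : z ∈ (extChartAt I x).target) (u : E) : fderiv ℝ (chartTransition I x x) z u = u := by
  rw [← tangentCoordChange_eq_fderiv I hz]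
  exact tangentCoordChange_self ((extChartAt I x).map_target hz)

lemma fderiv_chartTransition_surjective [IsManifold I 1 M] {x x' : M} {z : E}
    (hz : z ∈ (extChartAt I x).target)
    (hz' : (extChartAt I x).symm z ∈ (extChartAt I x').source) :
    Function.Surjective (fderiv ℝ (chartTransition I x x') z) := by
  intro w
  have h2 : chartTransition I x x' z ∈ (extChartAt I x').target := (extChartAt I x').map_source hz'
  have h3 : (extChartAt I x').symm (chartTransition I x x' z) = (extChartAt I x).symm z :=
    (extChartAt I x').left_inv hz'
  have h4 : chartTransition I x' x (chartTransition I x x' z) = z := by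
    rw [chartTransition, Function.comp_apply, h3, (extChartAt I x).right_inv hz]
  have h5 := fderiv_chartTransition_comp I (x' := x) (x'' := x') h2
    (h3 ▸ (extChartAt I x).map_target hz) (h3 ▸ hz') w
  rw [h4, fderiv_chartTransition_self I h2] at h5
  exact ⟨_, h5⟩

lemma eventually_mem_chartTransition_source {x x' : M} {z : E}
    (hz : z ∈ (extChartAt I x).target)
    (hz' : (extChartAt I x).symm z ∈ (extChartAt I x').source) :
    ∀ᶠ w in nhds z, w ∈ (extChartAt I x).target ∧
      (extChartAt I x).symm w ∈ (extChartAt I x').source :=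
  (Filter.eventually_mem_set.2 ((isOpen_extChartAt_target x).mem_nhds hz)).and
    ((continuousOn_extChartAt_symm x).continuousAt ((isOpen_extChartAt_target x).mem_nhds hz)
      ((isOpen_extChartAt_source x').mem_nhds hz'))

variable (g : ∀ x : M, TangentSpace I x →L[ℝ] TangentSpace I x →L[ℝ] ℝ)

lemma metricInChart_apply [IsManifold I 1 M] {x : M} {z : E} (hz : z ∈ (extChartAt I x).target)
    (u v : E) : metricInChart I g x z u v = g ((extChartAt I x).symm z)
      (fderiv ℝ (chartTransition I x ((extChartAt I x).symm z)) z u)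
      (fderiv ℝ (chartTransition I x ((extChartAt I x).symm z)) z v) := by
  rw [← coordVecAt_apply I hz, ← coordVecAt_apply I hz]
  rfl

/-- The transformation law of the coefficients of a metric. -/
lemma metricInChart_chartTransition [IsManifold I 1 M] {x x' : M} {z : E}
    (hz : z ∈ (extChartAt I x).target) (hz' : (extChartAt I x).symm z ∈ (extChartAt I x').source)
    (u v : E) :
    metricInChart I g x z u v = metricInChart I g x' (chartTransition I x x' z)
      (fderiv ℝ (chartTransition I x x') z u) (fderiv ℝ (chartTransition I x x') z v) := by
  have h2 : chartTransition I x x' z ∈ (extChartAt I x').target := (extChartAt I x').map_source hz'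
  have h3 : (extChartAt I x').symm (chartTransition I x x' z) = (extChartAt I x).symm z :=
    (extChartAt I x').left_inv hz'
  rw [metricInChart_apply I g hz, metricInChart_apply I g h2, h3,
    fderiv_chartTransition_comp I hz hz' (mem_extChartAt_source _),
    fderiv_chartTransition_comp I hz hz' (mem_extChartAt_source _)]

variable [IsManifold I ∞ M]
  (g : ContMDiffRiemannianMetric I ∞ E (fun x : M => TangentSpace I x))

lemma contDiffOn_metricInChart [FiniteDimensional ℝ E] (x : M) :
    ContDiffOn ℝ ∞ (metricInChart I g.inner x) (extChartAt I x).target := by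
  have := FiniteDimensional.complete ℝ E
  rw [contDiffOn_clm_apply]
  intro u
  rw [contDiffOn_clm_apply]
  intro v
  have hfield : ∀ u : E, ContMDiffOn 𝓘(ℝ, E) I.tangent ∞
      (fun z => TotalSpace.mk' E (E := fun x : M => TangentSpace I x) ((extChartAt I x).symm z)
        (fderiv ℝ (chartTransition I x ((extChartAt I x).symm z)) z u))
      (extChartAt I x).target := by
    intro u
    have h1 := contMDiffOn_extChartAt_symm (I := I.tangent) (n := ∞)
      (⟨x, 0⟩ : TangentBundle I M)
    have h2 : ContMDiff 𝓘(ℝ, E) 𝓘(ℝ, E × E) ∞ (fun z : E => (z, u)) := by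
      rw [contMDiff_iff_contDiff]; fun_prop
    refine (h1.comp (h2.contMDiffOn (s := (extChartAt I x).target)) ?_).congr ?_
    · exact fun z hz => (mem_extChartAt_tangent_target I _ _).2 hz
    · intro z hz
      rw [← tangentCoordChange_eq_fderiv I hz]
      rfl
  have hsymm := contMDiffOn_extChartAt_symm (I := I) (n := ∞) x
  have key : ContMDiffOn 𝓘(ℝ, E) (I.prod 𝓘(ℝ)) ∞
      (fun z => TotalSpace.mk' ℝ (E := Bundle.Trivial M ℝ) ((extChartAt I x).symm z)
        (g.inner ((extChartAt I x).symm z)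
          (fderiv ℝ (chartTransition I x ((extChartAt I x).symm z)) z u)
          (fderiv ℝ (chartTransition I x ((extChartAt I x).symm z)) z v)))
      (extChartAt I x).target := by
    apply ContMDiffOn.clm_bundle_apply₂ (F₁ := E) (F₂ := E)
    · exact g.contMDiff.comp_contMDiffOn hsymm
    · exact hfield u
    · exact hfield v
  intro z hz
  have key2 := key z hz
  simp only [contMDiffWithinAt_totalSpace] at key2
  refine (key2.2.contDiffWithinAt).congr ?_ ?_
  · intro z hz
    rw [metricInChart_apply I _ hz]; rfl
  · rw [metricInChart_apply I _ hz]; rfl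

lemma metricInChart_symm (x : M) {z : E} (hz : z ∈ (extChartAt I x).target) (u v : E) :
    metricInChart I g.inner x z u v = metricInChart I g.inner x z v u := by
  rw [metricInChart_apply I _ hz, metricInChart_apply I _ hz]
  exact g.symm _ _ _

lemma metricInChart_injective (x : M) {z : E} (hz : z ∈ (extChartAt I x).target) :
    Function.Injective (metricInChart I g.inner x z) := by
  rw [injective_iff_map_eq_zero]
  intro u hu
  by_contra hne
  have h1 : metricInChart I g.inner x z u u = 0 := by rw [hu]; rfl
  rw [metricInChart_apply I _ hz] at h1
  refine (g.pos _ _ ?_).ne' h1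
  intro h0
  apply hne
  have h2 := fderiv_chartTransition_comp I (x'' := x) hz (mem_extChartAt_source _)
    ((extChartAt I x).map_target hz) u
  rw [fderiv_chartTransition_self I hz] at h2
  rw [← h2]
  exact (congrArg _ h0).trans (map_zero _)

lemma isCoordMetricOn_metricInChart [FiniteDimensional ℝ E] (x : M) :
    IsCoordMetricOn (metricInChart I g.inner x) (extChartAt I x).target where
  isOpen := isOpen_extChartAt_target x
  contDiffOn := contDiffOn_metricInChart I g x
  symm := fun _ hz => metricInChart_symm I g x hz
  isInvertible := fun _ hz =>
    ContinuousLinearMap.isInvertible_of_injective (metricInChart_injective I g x hz)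

end Charts

section TangentBundleCharts

variable {E : Type*} [NormedAddCommGroup E] [NormedSpace ℝ E]
  {H : Type*} [TopologicalSpace H] (I : ModelWithCorners ℝ E H)
  {M : Type*} [TopologicalSpace M] [ChartedSpace H M] [IsManifold I ∞ M]

lemma horPart_apply (q : TangentBundle I M) (V : TangentSpace I.tangent q) :
    horPart I q V = (V : E × E).1 := by
  simp only [horPart, ContinuousLinearMap.comp_apply, ofCoord_apply, toCoord_apply]
  rfl

lemma vertPart_apply
    (g : ∀ x : M, TangentSpace I x →L[ℝ] TangentSpace I x →L[ℝ] ℝ)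
    (q : TangentBundle I M) (V : TangentSpace I.tangent q) :
    vertPart I g q V = (V : E × E).2 + christoffelCLM (metricInChart I g q.proj)
      (extChartAt I q.proj q.proj) q.snd (V : E × E).1 := by
  simp only [vertPart, ContinuousLinearMap.comp_apply, ofCoord_apply, toCoord_apply,
    christoffelAt]
  rfl

variable [I.Boundaryless]

/-- The change of coordinates of `TM` is `(x, y) ↦ (φ(x), dφ(x) y)`. -/
lemma chartTransition_tangent_apply (p q : TangentBundle I M) {z : E × E}
    (hz : z.1 ∈ (extChartAt I p.proj).target)
    (hz' : (extChartAt I p.proj).symm z.1 ∈ (extChartAt I q.proj).source) :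
    chartTransition I.tangent p q z = (chartTransition I p.proj q.proj z.1,
      fderiv ℝ (chartTransition I p.proj q.proj) z.1 z.2) := by
  have h1 := tangentCoordChange_comp (I := I) (w := p.proj) (x := (extChartAt I p.proj).symm z.1)
    (y := q.proj) (v := z.2)
    ⟨⟨(extChartAt I p.proj).map_target hz, mem_extChartAt_source _⟩, hz'⟩
  rw [← tangentCoordChange_eq_fderiv I hz, ← h1]
  rfl

lemma fderiv_chartTransition_tangent (p q : TangentBundle I M) {z : E × E}
    (hz : z.1 ∈ (extChartAt I p.proj).target)
    (hz' : (extChartAt I p.proj).symm z.1 ∈ (extChartAt I q.proj).source) (V : E × E) :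
    fderiv ℝ (chartTransition I.tangent p q) z V
      = (fderiv ℝ (chartTransition I p.proj q.proj) z.1 V.1,
        fderiv ℝ (fderiv ℝ (chartTransition I p.proj q.proj)) z.1 V.1 z.2
          + fderiv ℝ (chartTransition I p.proj q.proj) z.1 V.2) := by
  have hφ := contDiffAt_chartTransition I hz hz'
  have hφ1 := ((hφ.differentiableAt (by simp)).hasFDerivAt).comp z hasFDerivAt_fst
  have hφ2 := (((hφ.fderiv_right (m := ∞) (by simp)).differentiableAt
    (by simp)).hasFDerivAt).comp z hasFDerivAt_fst
  have h1 := hφ1.prodMk (hφ2.clm_apply hasFDerivAt_snd)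
  have h2 := h1.congr_of_eventuallyEq (f₁ := chartTransition I.tangent p q) (by
    filter_upwards [continuousAt_fst.eventually
      (eventually_mem_chartTransition_source I hz hz')] with z' hz'
    exact chartTransition_tangent_apply I p q hz'.1 hz'.2)
  rw [h2.fderiv]
  simp [add_comm]

variable [FiniteDimensional ℝ E]
  (g : ContMDiffRiemannianMetric I ∞ E (fun x : M => TangentSpace I x))

/-- The vertical part of a tangent vector, in the chart of `TM` at another point. -/
lemma vertPart_fderiv_chartTransition (p : TangentBundle I M) {z : E × E}
    (hz : z.1 ∈ (extChartAt I p.proj).target) (V : E × E) :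
    vertPart I g.inner ((extChartAt I.tangent p).symm z)
        (fderiv ℝ (chartTransition I.tangent p ((extChartAt I.tangent p).symm z)) z V)
      = fderiv ℝ (chartTransition I p.proj ((extChartAt I p.proj).symm z.1)) z.1
          (coordVert (metricInChart I g.inner p.proj) z V) := by
  set q := (extChartAt I.tangent p).symm z with hq
  have hqp : q.proj = (extChartAt I p.proj).symm z.1 := rfl
  have hqs : q.snd = fderiv ℝ (chartTransition I p.proj q.proj) z.1 z.2 := by
    rw [← tangentCoordChange_eq_fderiv I hz]
    rfl
  have hz' : (extChartAt I p.proj).symm z.1 ∈ (extChartAt I q.proj).source :=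
    mem_extChartAt_source _
  have hφ := contDiffAt_chartTransition I hz hz'
  have hs : ∀ u v, fderiv ℝ (fderiv ℝ (chartTransition I p.proj q.proj)) z.1 u v
      = fderiv ℝ (fderiv ℝ (chartTransition I p.proj q.proj)) z.1 v u :=
    hφ.isSymmSndFDerivAt
      (by rw [minSmoothness_of_isRCLikeNormedField]; exact WithTop.coe_le_coe.2 le_top)
  have key := fderiv_apply_christoffel (isCoordMetricOn_metricInChart I g p.proj)
    (isCoordMetricOn_metricInChart I g q.proj) hz ((extChartAt I q.proj).map_source hz') hφ
    (fderiv_chartTransition_surjective I hz hz')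
    ((eventually_mem_chartTransition_source I hz hz').mono fun z' hz' u v =>
      metricInChart_chartTransition I g.inner hz'.1 hz'.2 u v)
    z.2 V.1
  refine (vertPart_apply I g.inner q _).trans ?_
  rw [fderiv_chartTransition_tangent I p q hz hz', coordVert_apply, map_add]
  refine Eq.trans ?_ (congrArg _ key.symm)
  rw [hqs, hs]
  change _ + _ + christoffelCLM (metricInChart I g.inner q.proj)
    (chartTransition I p.proj q.proj z.1) _ _
      = fderiv ℝ (chartTransition I p.proj q.proj) z.1 V.2 + _
  dsimp only
  abel

/-- The coefficients of `a gˢ + b gʰ + c gᵛ` in the coordinates `(xⁱ, yⁱ)`. -/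
lemma metricInChart_gNatural (a b c : ℝ) (p : TangentBundle I M) {z : E × E}
    (hz : z.1 ∈ (extChartAt I p.proj).target) :
    metricInChart I.tangent (gNatural I g.inner a b c) p z
      = coordNatural (metricInChart I g.inner p.proj) a b c z := by
  have hzT := (mem_extChartAt_tangent_target I p z).2 hz
  refine ContinuousLinearMap.ext fun V => ContinuousLinearMap.ext fun W => ?_
  rw [metricInChart_apply I.tangent _ hzT, coordNatural_apply]
  refine (gNatural_apply I g.inner a b c _ _ _).trans ?_
  have hv := vertPart_fderiv_chartTransition I g p hz
  have hh : ∀ V : E × E, horPart I ((extChartAt I.tangent p).symm z)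
      (fderiv ℝ (chartTransition I.tangent p ((extChartAt I.tangent p).symm z)) z V)
      = fderiv ℝ (chartTransition I p.proj ((extChartAt I p.proj).symm z.1)) z.1 V.1 := by
    intro V
    refine (horPart_apply I _ _).trans ?_
    rw [fderiv_chartTransition_tangent I p _ hz (mem_extChartAt_source _)]
    rfl
  simp only [metricInChart_apply I g.inner hz]
  rw [hv, hv, hh, hh]
  rfl

/-- The curvature of `a gˢ + b gʰ + c gᵛ` on two vertical lifts and a horizontal lift. -/
theorem riemannCurv_gNatural_vertLift_vertLift_horLift {a b c α : ℝ}
    (hα : α = a * (a + c) - b ^ 2) (hα0 : α ≠ 0) (p : TangentBundle I M)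
    (X Y Z : TangentSpace I p.proj) :
    riemannCurv I.tangent (gNatural I g.inner a b c) p
        (vertLift I p X) (vertLift I p Y) (horLift I g.inner p Z)
      = horLift I g.inner p
          ((a ^ 2 / α) • riemannCurv I g.inner p.proj X Y Z
            + (a ^ 4 / (4 * α ^ 2)) •
              (riemannCurv I g.inner p.proj X p.snd (riemannCurv I g.inner p.proj Y p.snd Z)
                - riemannCurv I g.inner p.proj Y p.snd (riemannCurv I g.inner p.proj X p.snd Z)))
        + vertLift I p
          ((a * b / α) • riemannCurv I g.inner p.proj Y X Z
            + (a ^ 3 * b / (4 * α ^ 2)) •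
              (riemannCurv I g.inner p.proj Y p.snd (riemannCurv I g.inner p.proj X p.snd Z)
                - riemannCurv I g.inner p.proj X p.snd
                  (riemannCurv I g.inner p.proj Y p.snd Z))) := by
  have := FiniteDimensional.complete ℝ E
  have HM := isCoordMetricOn_metricInChart I g p.proj
  have hx := mem_extChartAt_target (I := I) p.proj
  have HG := HM.coordNatural (hα ▸ hα0)
  have hR : ∀ X Y Z : TangentSpace I p.proj, riemannCurv I g.inner p.proj X Y Z
      = ofCoord I p.proj (coordRiem (metricInChart I g.inner p.proj) (extChartAt I p.proj p.proj)
        (toCoord I p.proj X) (toCoord I p.proj Y) (toCoord I p.proj Z)) := by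
    intro X Y Z
    rw [riemannCurv, HM.coordCurv_const hx]
  have hbase : extChartAt I.tangent p p
      = (extChartAt I p.proj p.proj, toCoord I p.proj p.snd) := by
    rw [toCoord_apply]
    refine Prod.ext rfl ?_
    exact tangentCoordChange_self (mem_extChartAt_source _)
  have hev : metricInChart I.tangent (gNatural I g.inner a b c) p
      =ᶠ[nhds (extChartAt I.tangent p p)] coordNatural (metricInChart I g.inner p.proj) a b c := by
    rw [hbase]
    filter_upwards [continuousAt_fst.eventually
      ((isOpen_extChartAt_target p.proj).mem_nhds hx)] with z hz
    exact metricInChart_gNatural I g a b c p hz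
  rw [riemannCurv, hev.coordCurv_eq, hbase, HG.coordCurv_const ⟨hx, trivial⟩]
  simp only [vertLift, horLift, toCoord_ofCoord, christoffelAt, ← christoffelCLM_apply]
  rw [HM.coordRiem_coordNatural hα hα0 hx]
  simp only [hR, map_add, map_sub, map_smul, toCoord_ofCoord]
  rw [← map_add, Prod.mk_add_mk, add_zero]

end TangentBundleCharts

end

theorem stmt_1 {n : ℕ} (hn : 3 ≤ n)
    {M : Type*} [TopologicalSpace M] [T2Space M] [SecondCountableTopology M]
    [ChartedSpace (EuclideanSpace ℝ (Fin n)) M] [IsManifold (𝓡 n) ∞ M]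
    (g : ContMDiffRiemannianMetric (𝓡 n) ∞ (EuclideanSpace ℝ (Fin n))
      (fun x : M => TangentSpace (𝓡 n) x))
    (a b c α : ℝ) (ha : 0 < a) (hα : α = a * (a + c) - b ^ 2) (hαpos : 0 < α)
    (X Y Z : ∀ x : M, TangentSpace (𝓡 n) x)
    (x : M) (y : TangentSpace (𝓡 n) x) :
    let t : TangentSpace (𝓡 n) x := y
    let p : TangentBundle (𝓡 n) M := ⟨x, y⟩
    let R := riemannCurv (𝓡 n) g.inner x
    riemannCurv (𝓡 n).tangent (gNatural (𝓡 n) g.inner a b c) p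
        (vertLift (𝓡 n) p (X x)) (vertLift (𝓡 n) p (Y x)) (horLift (𝓡 n) g.inner p (Z x))
      = horLift (𝓡 n) g.inner p
          ((a ^ 2 / α) • R (X x) (Y x) (Z x)
            + (a ^ 4 / (4 * α ^ 2)) • (R (X x) t (R (Y x) t (Z x)) - R (Y x) t (R (X x) t (Z x))))
        + vertLift (𝓡 n) p
          ((a * b / α) • R (Y x) (X x) (Z x)
            + (a ^ 3 * b / (4 * α ^ 2)) •
              (R (Y x) t (R (X x) t (Z x)) - R (X x) t (R (Y x) t (Z x)))) := by
  intro t p R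
  exact riemannCurv_gNatural_vertLift_vertLift_horLift (𝓡 n) g hα hαpos.ne' p (X x) (Y x) (Z x)
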